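/- arXiv:1608.03043 — 2 statements merged into one kernel-verified Lean document; each statement's English description precedes it below -/
import Mathlib

section
/- Let ⟨X,d⟩ and ⟨Y,ρ⟩ be metric spaces, f : X → Y a continuous function, and let ⟨A_λ⟩_{λ∈Λ} be a net of nonempty subsets of X converging to a nonempty subset A of X in the locally finite topology, i.e.: (a) for every open set V of X with A ⊆ V one has A_λ ⊆ V eventually, and (b) for every locally finite family 𝒱 of open subsets of X such that A intersects every member of 𝒱, eventually A_λ intersects every member of 𝒱. Then lim_{λ∈Λ} Ω(f,A_λ) = Ω(f,A) in [0,∞]. -/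
open Metric Filter ENNReal Topology

/-- The `ε`-enlargement `S_d(A,ε) = ⋃_{a ∈ A} S_d(a,ε)` of a set `A`. -/
def SEnl {X : Type*} [MetricSpace X] (A : Set X) (ε : ℝ) : Set X :=
  ⋃ a ∈ A, Metric.ball a ε

/-- `Ω_n(f,A) = sup {ρ(f x, f w) : x, w ∈ S_d(A,1/n), d(x,w) < 1/n}` in `[0,∞]`. -/
noncomputable def OmegaN {X Y : Type*} [MetricSpace X] [MetricSpace Y]
    (f : X → Y) (A : Set X) (n : ℕ) : ℝ≥0∞ :=
  ⨆ (x ∈ SEnl A (1 / (n : ℝ))) (w ∈ SEnl A (1 / (n : ℝ))) (_ : dist x w < 1 / (n : ℝ)),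
    edist (f x) (f w)

/-- The oscillation `Ω(f,A) = inf_{n ≥ 1} Ω_n(f,A)` of `f` at `A`. -/
noncomputable def Omega {X Y : Type*} [MetricSpace X] [MetricSpace Y]
    (f : X → Y) (A : Set X) : ℝ≥0∞ :=
  ⨅ n : ℕ, OmegaN f A (n + 1)

theorem mem_SEnl {X : Type*} [MetricSpace X] {A : Set X} {ε : ℝ} {x : X} :
    x ∈ SEnl A ε ↔ ∃ a ∈ A, dist x a < ε := by
  simp [SEnl]

theorem isOpen_SEnl {X : Type*} [MetricSpace X] (A : Set X) (ε : ℝ) : IsOpen (SEnl A ε) :=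
  isOpen_biUnion fun _ _ => isOpen_ball

theorem subset_SEnl {X : Type*} [MetricSpace X] (A : Set X) {ε : ℝ} (hε : 0 < ε) :
    A ⊆ SEnl A ε :=
  fun x hx => mem_SEnl.2 ⟨x, hx, by simpa using hε⟩

/-- Enlarging a subset of an enlargement. -/
theorem SEnl_subset_of_subset_SEnl {X : Type*} [MetricSpace X] {A B : Set X} {ε δ η : ℝ}
    (h : B ⊆ SEnl A δ) (hη : ε + δ ≤ η) : SEnl B ε ⊆ SEnl A η := by
  intro x hx
  obtain ⟨b, hb, hxb⟩ := mem_SEnl.1 hx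
  obtain ⟨a, ha, hba⟩ := mem_SEnl.1 (h hb)
  exact mem_SEnl.2 ⟨a, ha, by linarith [dist_triangle x b a]⟩

theorem lt_OmegaN_iff {X Y : Type*} [MetricSpace X] [MetricSpace Y] {f : X → Y} {A : Set X}
    {n : ℕ} {c : ℝ≥0∞} :
    c < OmegaN f A n ↔ ∃ x ∈ SEnl A (1 / (n : ℝ)), ∃ w ∈ SEnl A (1 / (n : ℝ)),
      dist x w < 1 / (n : ℝ) ∧ c < edist (f x) (f w) := by
  simp only [OmegaN, lt_iSup_iff, exists_prop]

theorem edist_le_OmegaN {X Y : Type*} [MetricSpace X] [MetricSpace Y] (f : X → Y) {A : Set X}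
    {n : ℕ} {x w : X} (hx : x ∈ SEnl A (1 / (n : ℝ))) (hw : w ∈ SEnl A (1 / (n : ℝ)))
    (hxw : dist x w < 1 / (n : ℝ)) : edist (f x) (f w) ≤ OmegaN f A n :=
  le_iSup₂_of_le x hx (le_iSup₂_of_le w hw (le_iSup_of_le hxw le_rfl))

theorem OmegaN_le_OmegaN {X Y : Type*} [MetricSpace X] [MetricSpace Y] (f : X → Y)
    {A B : Set X} {m n : ℕ} (h : SEnl A (1 / (m : ℝ)) ⊆ SEnl B (1 / (n : ℝ)))
    (hmn : 1 / (m : ℝ) ≤ 1 / (n : ℝ)) : OmegaN f A m ≤ OmegaN f B n :=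
  iSup₂_le fun _ hx => iSup₂_le fun _ hw => iSup_le fun hxw =>
    edist_le_OmegaN f (h hx) (h hw) (hxw.trans_le hmn)

/-- The oscillation is upper semicontinuous: a bound at `A` persists for all sets contained in
some open neighbourhood of `A`. -/
theorem exists_isOpen_forall_subset_Omega_lt {X Y : Type*} [MetricSpace X] [MetricSpace Y]
    {f : X → Y} {A : Set X} {c : ℝ≥0∞} (h : Omega f A < c) :
    ∃ V, IsOpen V ∧ A ⊆ V ∧ ∀ B ⊆ V, Omega f B < c := by
  obtain ⟨n, hn⟩ := iInf_lt_iff.1 h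
  have add_halves : (1 : ℝ) / ((2 * n + 1 + 1 : ℕ) : ℝ) + 1 / ((2 * n + 1 + 1 : ℕ) : ℝ)
      = 1 / ((n + 1 : ℕ) : ℝ) := by
    push_cast
    field_simp
    ring
  have hpos : (0 : ℝ) < 1 / ((2 * n + 1 + 1 : ℕ) : ℝ) := by positivity
  refine ⟨SEnl A (1 / ((2 * n + 1 + 1 : ℕ) : ℝ)), isOpen_SEnl _ _, subset_SEnl _ hpos,
    fun B hB => ((iInf_le _ (2 * n + 1)).trans
    (OmegaN_le_OmegaN (m := 2 * n + 1 + 1) (n := n + 1) f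
      (SEnl_subset_of_subset_SEnl hB add_halves.le) (by linarith))).trans_lt hn⟩

/-- If `f` is continuous and separates `x n` from `w n` by more than `c > 0`, where both are at
distance less than `2 * r n` from `a n` and `r n → 0`, then the balls of radius `r n` about `a n`
form a locally finite family. -/
theorem locallyFinite_ball_of_lt_edist {X Y : Type*} [MetricSpace X] [MetricSpace Y]
    {f : X → Y} (hf : Continuous f) {c : ℝ≥0∞} (hc : 0 < c) {r : ℕ → ℝ}
    (hr : Tendsto r atTop (𝓝 0)) {a x w : ℕ → X} (hx : ∀ n, dist (x n) (a n) < 2 * r n)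
    (hw : ∀ n, dist (w n) (a n) < 2 * r n) (hxw : ∀ n, c < edist (f (x n)) (f (w n))) :
    LocallyFinite fun n => ball (a n) (r n) := by
  intro p
  obtain ⟨δ, hδ, hfδ⟩ := Metric.mem_nhds_iff.1
    (hf.continuousAt.preimage_mem_nhds (Metric.eball_mem_nhds (f p) (ENNReal.half_pos hc.ne')))
  refine ⟨ball p (δ / 4), ball_mem_nhds p (by positivity), ?_⟩
  obtain ⟨N, hN⟩ := eventually_atTop.1 (hr.eventually_lt_const (by positivity : 0 < δ / 4))
  refine (Set.finite_lt_nat N).subset fun n hn => ?_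
  obtain ⟨q, hqa, hqp⟩ := hn
  by_contra hlt
  have hrn := hN n (not_lt.1 hlt)
  rw [mem_ball] at hqa hqp
  have hap : dist (a n) p < δ / 2 := by
    linarith [dist_triangle_left (a n) p q]
  have hxp : edist (f (x n)) (f p) < c / 2 :=
    hfδ (mem_ball.2 (by linarith [dist_triangle (x n) (a n) p, hx n]))
  have hwp : edist (f (w n)) (f p) < c / 2 :=
    hfδ (mem_ball.2 (by linarith [dist_triangle (w n) (a n) p, hw n]))
  refine lt_asymm (hxw n) ((edist_triangle_right _ _ (f p)).trans_lt ?_)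
  simpa only [ENNReal.add_halves] using ENNReal.add_lt_add hxp hwp

/-- The oscillation of a continuous function is lower semicontinuous with respect to hitting
locally finite families of open sets. -/
theorem exists_locallyFinite_forall_le_Omega {X Y : Type*} [MetricSpace X] [MetricSpace Y]
    {f : X → Y} (hf : Continuous f) {A : Set X} {c : ℝ≥0∞} (hc : 0 < c) (h : c < Omega f A) :
    ∃ 𝒱 : Set (Set X), (∀ V ∈ 𝒱, IsOpen V) ∧ LocallyFinite (fun V : 𝒱 => (V : Set X)) ∧
      (∀ V ∈ 𝒱, (A ∩ V).Nonempty) ∧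
      ∀ B : Set X, (∀ V ∈ 𝒱, (B ∩ V).Nonempty) → c ≤ Omega f B := by
  choose x hx w hw hxw hfxw using fun n : ℕ =>
    lt_OmegaN_iff.1 (h.trans_le (iInf_le (fun n : ℕ => OmegaN f A (n + 1)) n))
  choose a haA hxa using fun n => mem_SEnl.1 (hx n)
  set r : ℕ → ℝ := fun n => 1 / ((n + 1 : ℕ) : ℝ) with hr_def
  have hr_pos : ∀ n, 0 < r n := fun n => by positivity
  have hr : Tendsto r atTop (𝓝 0) := by
    simpa [hr_def] using tendsto_one_div_add_atTop_nhds_zero_nat (𝕜 := ℝ)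
  have hwa : ∀ n, dist (w n) (a n) < 2 * r n := fun n => by
    linarith [dist_triangle_left (w n) (a n) (x n), hxw n, hxa n]
  have hlf := locallyFinite_ball_of_lt_edist hf hc hr
    (fun n => by linarith [hxa n, hr_pos n]) hwa hfxw
  refine ⟨Set.range fun n => ball (a n) (r n), ?_, hlf.on_range, ?_, fun B hB => ?_⟩
  · rintro _ ⟨n, rfl⟩
    exact isOpen_ball
  · rintro _ ⟨n, rfl⟩
    exact ⟨a n, haA n, mem_ball_self (hr_pos n)⟩
  · refine le_iInf fun k => ?_
    obtain ⟨b, hbB, hb⟩ := hB _ ⟨3 * k + 2, rfl⟩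
    rw [mem_ball'] at hb
    have hrk : 3 * r (3 * k + 2) = 1 / ((k + 1 : ℕ) : ℝ) := by
      simp only [hr_def]
      push_cast
      field_simp
      ring
    have hpos := hr_pos (3 * k + 2)
    have hxb := dist_triangle (x (3 * k + 2)) (a (3 * k + 2)) b
    have hwb := dist_triangle (w (3 * k + 2)) (a (3 * k + 2)) b
    have hxa' := hxa (3 * k + 2)
    have hwa' := hwa (3 * k + 2)
    have hxw' := hxw (3 * k + 2)
    exact (hfxw _).le.trans (edist_le_OmegaN f (mem_SEnl.2 ⟨b, hbB, by linarith⟩)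
      (mem_SEnl.2 ⟨b, hbB, by linarith⟩) (by linarith))

/-- If `f` is continuous and the net `⟨A_λ⟩` of nonempty sets converges to the nonempty set
`A` in the locally finite topology, then `Ω(f,A_λ) → Ω(f,A)` in `[0,∞]`. -/
theorem oscillation_continuous_locallyFinite_topology
    {X Y Λ : Type*} [MetricSpace X] [MetricSpace Y] [Nonempty Λ] [Preorder Λ]
    (hdir : ∀ a b : Λ, ∃ c : Λ, a ≤ c ∧ b ≤ c)
    (f : X → Y) (hf : Continuous f)
    (A : Λ → Set X) (hAne : ∀ l, (A l).Nonempty)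
    (A₀ : Set X) (hA₀ : A₀.Nonempty)
    (ha : ∀ V : Set X, IsOpen V → A₀ ⊆ V → ∀ᶠ l in atTop, A l ⊆ V)
    (hb : ∀ 𝒱 : Set (Set X), (∀ V ∈ 𝒱, IsOpen V) →
      LocallyFinite (fun V : 𝒱 => (V : Set X)) →
      (∀ V ∈ 𝒱, (A₀ ∩ V).Nonempty) →
      ∀ᶠ l in atTop, ∀ V ∈ 𝒱, (A l ∩ V).Nonempty) :
    Tendsto (fun l => Omega f (A l)) atTop (𝓝 (Omega f A₀)) := by
  refine tendsto_order.2 ⟨fun c hc => ?_, fun c hc => ?_⟩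
  · obtain ⟨c', hcc, hc'⟩ := exists_between hc
    obtain ⟨𝒱, hopen, hlf, hA, hB⟩ :=
      exists_locallyFinite_forall_le_Omega hf (bot_le.trans_lt hcc) hc'
    exact (hb 𝒱 hopen hlf hA).mono fun l hl => hcc.trans_le (hB _ hl)
  · obtain ⟨V, hV, hAV, hB⟩ := exists_isOpen_forall_subset_Omega_lt hc
    exact (ha V hV hAV).mono fun l hl => hB _ hl
end

section
/- Let ⟨X,d⟩ be a metric space and let A be a nonempty subset of X that is not a UC-subset, i.e., there exists a sequence ⟨a_n⟩ in A with lim_{n→∞} d(a_n, X ∖ {a_n}) = 0 that has no cluster point in X. Then there exist nonempty closed subsets C and E of X with C ⊆ A, C ∩ E = ∅, and inf{d(c,e) : c ∈ C, e ∈ E} = 0. -/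
open Metric Filter ENNReal Topology

/-- `A` is a UC-subset: every sequence `⟨a_n⟩` in `A` with
`d(a_n, X ∖ {a_n}) → 0` has a cluster point in `X`. -/
def IsUCSubset {X : Type*} [MetricSpace X] (A : Set X) : Prop :=
  ∀ a : ℕ → X, (∀ n, a n ∈ A) →
    Tendsto (fun n => Metric.infDist (a n) ({a n}ᶜ)) atTop (𝓝 0) →
    ∃ x : X, MapClusterPt x atTop a

/-- The gap `inf {d(c,e) : c ∈ C, e ∈ E}` between two sets. -/
noncomputable def gap {X : Type*} [MetricSpace X] (C E : Set X) : ℝ :=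
  sInf {r : ℝ | ∃ c ∈ C, ∃ e ∈ E, r = dist c e}

/-- A sequence without cluster points is locally finite. -/
theorem locallyFinite_singleton_of_forall_not_mapClusterPt {X : Type*} [TopologicalSpace X]
    {u : ℕ → X} (h : ∀ x, ¬ MapClusterPt x atTop u) :
    LocallyFinite fun n => ({u n} : Set X) := by
  intro x
  have hx := h x
  rw [mapClusterPt_iff_frequently] at hx
  push Not at hx
  obtain ⟨s, hs, hus⟩ := hx
  refine ⟨s, hs, ?_⟩
  rw [← Nat.cofinite_eq_atTop, eventually_cofinite] at hus
  simpa using hus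

/-- The range of a sequence without cluster points in a T₁ space is closed, and the same holds
for all of its subsequences. -/
theorem isClosed_range_comp_of_forall_not_mapClusterPt {X : Type*} [TopologicalSpace X]
    [T1Space X] {u : ℕ → X} (h : ∀ x, ¬ MapClusterPt x atTop u) {f : ℕ → ℕ}
    (hf : Function.Injective f) : IsClosed (Set.range (u ∘ f)) := by
  rw [← Set.iUnion_singleton_eq_range]
  exact ((locallyFinite_singleton_of_forall_not_mapClusterPt h).comp_injective hf).isClosed_iUnion
    fun _ => isClosed_singleton

/-- A sequence without cluster points eventually avoids any given point. -/
theorem eventually_ne_of_not_mapClusterPt {X : Type*} [TopologicalSpace X]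
    {u : ℕ → X} {x : X} (h : ¬ MapClusterPt x atTop u) : ∀ᶠ n in atTop, u n ≠ x := by
  rw [mapClusterPt_iff_frequently] at h
  push Not at h
  obtain ⟨s, hs, hus⟩ := h
  filter_upwards [hus] with n hn hnx
  exact hn (hnx ▸ mem_of_mem_nhds hs)

/-- Sequences at vanishing distance have the same cluster points. -/
theorem MapClusterPt.of_tendsto_dist {X : Type*} [PseudoMetricSpace X] {u v : ℕ → X} {x : X}
    (hv : MapClusterPt x atTop v) (huv : Tendsto (fun n => dist (u n) (v n)) atTop (𝓝 0)) :
    MapClusterPt x atTop u := by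
  rw [mapClusterPt_iff_frequently] at hv ⊢
  intro s hs
  obtain ⟨ε, hε, hεs⟩ := Metric.mem_nhds_iff.1 hs
  refine ((hv _ (ball_mem_nhds x (half_pos hε))).and_eventually
    (huv.eventually (gt_mem_nhds (half_pos hε)))).mono fun n hn => hεs ?_
  have h₁ := mem_ball.1 hn.1
  have h₂ := dist_triangle (u n) (v n) x
  exact mem_ball.2 (by linarith [hn.2])

/-- Two sequences that eventually avoid every point and never agree at the same index have
subsequences, along the same indices, with disjoint ranges. -/
theorem exists_strictMono_forall_ne {X : Type*} {u v : ℕ → X}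
    (hu : ∀ x, ∀ᶠ n in atTop, u n ≠ x) (hv : ∀ x, ∀ᶠ n in atTop, v n ≠ x)
    (huv : ∀ n, u n ≠ v n) :
    ∃ f : ℕ → ℕ, StrictMono f ∧ ∀ i j, u (f i) ≠ v (f j) := by
  obtain ⟨f, -, hf⟩ := exists_seq_of_forall_finset_exists (fun _ : ℕ => True)
    (fun m n => m < n ∧ u n ≠ v m ∧ v n ≠ u m) (fun s _ => by
      have h : ∀ᶠ n in atTop, ∀ m ∈ s, m < n ∧ u n ≠ v m ∧ v n ≠ u m :=
        (Filter.eventually_all_finset s).2 fun m _ =>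
          (eventually_gt_atTop m).and ((hu (v m)).and (hv (u m)))
      obtain ⟨n, hn⟩ := h.exists
      exact ⟨n, trivial, hn⟩)
  refine ⟨f, fun m n hmn => (hf m n hmn).1, fun i j => ?_⟩
  rcases lt_trichotomy i j with hij | rfl | hij
  · exact (hf i j hij).2.2.symm
  · exact huv _
  · exact (hf j i hij).2.1

/-- The gap between two sets vanishes as soon as they contain sequences at vanishing distance. -/
theorem gap_eq_zero_of_tendsto {X : Type*} [MetricSpace X] {C E : Set X} {u v : ℕ → X}
    (hu : ∀ n, u n ∈ C) (hv : ∀ n, v n ∈ E)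
    (huv : Tendsto (fun n => dist (u n) (v n)) atTop (𝓝 0)) : gap C E = 0 := by
  have h₀ : ∀ r ∈ {r : ℝ | ∃ c ∈ C, ∃ e ∈ E, r = dist c e}, 0 ≤ r := by
    rintro _ ⟨c, _, e, _, rfl⟩
    exact dist_nonneg
  refine le_antisymm (ge_of_tendsto' huv fun n => ?_) (Real.sInf_nonneg h₀)
  exact csInf_le ⟨0, h₀⟩ ⟨u n, hu n, v n, hv n, rfl⟩

/-- Points with small distance to the complement of themselves have close distinct companions. -/
theorem exists_ne_tendsto_dist {X : Type*} [MetricSpace X] [Nontrivial X] {a : ℕ → X}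
    (h : Tendsto (fun n => Metric.infDist (a n) ({a n}ᶜ)) atTop (𝓝 0)) :
    ∃ b : ℕ → X, (∀ n, a n ≠ b n) ∧ Tendsto (fun n => dist (a n) (b n)) atTop (𝓝 0) := by
  have hb : ∀ n, ∃ y ∈ ({a n}ᶜ : Set X),
      dist (a n) y < infDist (a n) ({a n}ᶜ) + 1 / ((n : ℝ) + 1) := fun n =>
    (infDist_lt_iff (Set.nonempty_compl_of_nontrivial (a n))).1
      (lt_add_of_pos_right _ Nat.one_div_pos_of_nat)
  choose b hne hlt using hb
  refine ⟨b, fun n => (hne n ·.symm), squeeze_zero (fun _ => dist_nonneg) (fun n => (hlt n).le) ?_⟩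
  simpa using h.add tendsto_one_div_add_atTop_nhds_zero_nat

/-- If `A` fails to be a UC-subset, as witnessed by a sequence `⟨a_n⟩` in `A` with
`d(a_n, X ∖ {a_n}) → 0` having no cluster point, then there exist disjoint nonempty
closed sets `C ⊆ A` and `E` with gap zero between them. -/
theorem exists_asymptotic_closed_sets_of_not_UC
    {X : Type*} [MetricSpace X] (A : Set X) (hA : A.Nonempty)
    (a : ℕ → X) (ha : ∀ n, a n ∈ A)
    (hiso : Tendsto (fun n => Metric.infDist (a n) ({a n}ᶜ)) atTop (𝓝 0))
    (hnc : ¬ ∃ x : X, MapClusterPt x atTop a) :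
    ∃ C E : Set X, C.Nonempty ∧ E.Nonempty ∧ IsClosed C ∧ IsClosed E ∧
      C ⊆ A ∧ C ∩ E = ∅ ∧ gap C E = 0 := by
  push Not at hnc
  have hu := fun x => eventually_ne_of_not_mapClusterPt (hnc x)
  have : Nontrivial X := by
    obtain ⟨n, hn⟩ := (hu (a 0)).exists
    exact ⟨a n, a 0, hn⟩
  obtain ⟨b, hab, hlim⟩ := exists_ne_tendsto_dist hiso
  have hnb : ∀ x, ¬ MapClusterPt x atTop b := fun x hx => hnc x (hx.of_tendsto_dist hlim)
  obtain ⟨f, hf, hne⟩ := exists_strictMono_forall_ne hu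
    (fun x => eventually_ne_of_not_mapClusterPt (hnb x)) hab
  refine ⟨Set.range (a ∘ f), Set.range (b ∘ f), Set.range_nonempty _, Set.range_nonempty _,
    isClosed_range_comp_of_forall_not_mapClusterPt hnc hf.injective,
    isClosed_range_comp_of_forall_not_mapClusterPt hnb hf.injective,
    Set.range_subset_iff.2 fun n => ha (f n), ?_,
    gap_eq_zero_of_tendsto Set.mem_range_self Set.mem_range_self (hlim.comp hf.tendsto_atTop)⟩
  rw [← Set.disjoint_iff_inter_eq_empty, Set.disjoint_left]
  rintro _ ⟨i, rfl⟩ ⟨j, hj⟩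
  exact hne i j hj.symm
end
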